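/- arXiv:1805.06102 — 7 statements merged into one kernel-verified Lean document; each statement's English description precedes it below -/
import Mathlib

section
/- Let v_th > 0, r_r > 0, x_th > 0 and r_s ≥ 0, and define T_e(s) = v_th² · (r_r/s) / ((r_s − r_r/s)² + x_th²) for s > 0, and s_max = r_r / √(r_s² + x_th²). Then T_e is strictly increasing on the interval (0, s_max]. -/
/-- The electrical torque `T_e` is strictly increasing on `(0, s_max]`. -/
theorem electrical_torque_strictMonoOn (vth rr xth rs : ℝ)
    (hv : 0 < vth) (hr : 0 < rr) (hx : 0 < xth) (hs : 0 ≤ rs) :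
    let Te : ℝ → ℝ := fun s => vth ^ 2 * (rr / s) / ((rs - rr / s) ^ 2 + xth ^ 2)
    let smax : ℝ := rr / Real.sqrt (rs ^ 2 + xth ^ 2)
    StrictMonoOn Te (Set.Ioc 0 smax) := by
  intro Te smax a ha b hb hab
  have hZ : 0 < Real.sqrt (rs ^ 2 + xth ^ 2) := Real.sqrt_pos.mpr (by positivity)
  have hZ2 : Real.sqrt (rs ^ 2 + xth ^ 2) ^ 2 = rs ^ 2 + xth ^ 2 :=
    Real.sq_sqrt (by positivity)
  have hb2 : b ≤ rr / Real.sqrt (rs ^ 2 + xth ^ 2) := hb.2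
  have hw : Real.sqrt (rs ^ 2 + xth ^ 2) ≤ rr / b := by
    rw [le_div_iff₀ hZ] at hb2
    rw [le_div_iff₀ hb.1]
    linarith
  have hu : rr / b < rr / a := div_lt_div_of_pos_left hr ha.1 hab
  change vth ^ 2 * (rr / a) / ((rs - rr / a) ^ 2 + xth ^ 2)
    < vth ^ 2 * (rr / b) / ((rs - rr / b) ^ 2 + xth ^ 2)
  generalize rr / a = u at *
  generalize rr / b = w at *
  generalize Real.sqrt (rs ^ 2 + xth ^ 2) = Z at *
  have hw0 : 0 < w := lt_of_lt_of_le hZ hw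
  have h1 : Z ^ 2 < u * w := by nlinarith
  have h2 : 0 < (u - w) * (u * w - Z ^ 2) := mul_pos (by linarith) (by linarith)
  rw [div_lt_div_iff₀ (by positivity) (by positivity), mul_assoc, mul_assoc]
  apply mul_lt_mul_of_pos_left _ (by positivity)
  rw [hZ2] at h2
  nlinarith
end

section
/- Let v_th > 0, r_r > 0, x_th > 0 and r_s ≥ 0, and define T_e(s) = v_th² · (r_r/s) / ((r_s − r_r/s)² + x_th²) for s > 0, and s_max = r_r / √(r_s² + x_th²). Then T_e is strictly decreasing on the interval [s_max, ∞). -/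
/-- The electrical torque `T_e` is strictly decreasing on `[s_max, ∞)`. -/
theorem electrical_torque_strictAntiOn (vth rr xth rs : ℝ)
    (hv : 0 < vth) (hr : 0 < rr) (hx : 0 < xth) (hs : 0 ≤ rs) :
    let Te : ℝ → ℝ := fun s => vth ^ 2 * (rr / s) / ((rs - rr / s) ^ 2 + xth ^ 2)
    let smax : ℝ := rr / Real.sqrt (rs ^ 2 + xth ^ 2)
    StrictAntiOn Te (Set.Ici smax) := by
  intro Te smax a ha b hb hab
  have hR2 : 0 < rs ^ 2 + xth ^ 2 := by positivity
  have hR : 0 < Real.sqrt (rs ^ 2 + xth ^ 2) := Real.sqrt_pos.mpr hR2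
  have hsq := Real.sq_sqrt hR2.le
  have hsm : 0 < smax := div_pos hr hR
  have ha' : rr / Real.sqrt (rs ^ 2 + xth ^ 2) ≤ a := ha
  have ha0 : 0 < a := lt_of_lt_of_le hsm ha
  have hb0 : 0 < b := ha0.trans hab
  have hu : rr / a ≤ Real.sqrt (rs ^ 2 + xth ^ 2) := by
    rw [div_le_iff₀ hR] at ha'
    rw [div_le_iff₀ ha0]
    linarith
  have hwu : rr / b < rr / a := div_lt_div_of_pos_left hr ha0 hab
  have hw0 : 0 < rr / b := div_pos hr hb0
  show vth ^ 2 * (rr / b) / ((rs - rr / b) ^ 2 + xth ^ 2)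
    < vth ^ 2 * (rr / a) / ((rs - rr / a) ^ 2 + xth ^ 2)
  generalize rr / a = u at *
  generalize rr / b = w at *
  generalize Real.sqrt (rs ^ 2 + xth ^ 2) = R at *
  have hu0 : 0 < u := hw0.trans hwu
  have h1 : w * u < rs ^ 2 + xth ^ 2 := by
    have : w * u < u * u := mul_lt_mul_of_pos_right hwu hu0
    have h2 : u * u ≤ R * R := mul_self_le_mul_self hu0.le hu
    nlinarith
  rw [div_lt_div_iff₀ (by positivity) (by positivity)]
  have h3 : 0 < vth ^ 2 * ((u - w) * (rs ^ 2 + xth ^ 2 - w * u)) :=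
    mul_pos (by positivity) (mul_pos (sub_pos.mpr hwu) (sub_pos.mpr h1))
  linarith
end

section
/- Let v_th > 0, r_r > 0, x_th > 0 and r_s ≥ 0, and define T_e(s) = v_th² · (r_r/s) / ((r_s − r_r/s)² + x_th²) for s > 0, and s_max = r_r / √(r_s² + x_th²). Then for every s > 0 with s ≠ s_max one has T_e(s) < T_e(s_max), and the maximum value is T_e(s_max) = v_th² / (2(√(r_s² + x_th²) − r_s)). In particular the maximum electrical torque does not depend on the rotor resistance r_r. -/
/-- The electrical torque attains its maximum over `(0, ∞)` at the pull-out slip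
`s_max = r_r/√(r_s² + x_th²)`, with value `v_th² / (2(√(r_s² + x_th²) − r_s))`,
which does not depend on the rotor resistance `r_r`. -/
theorem electrical_torque_max (vth rr xth rs : ℝ)
    (hv : 0 < vth) (hr : 0 < rr) (hx : 0 < xth) (hs : 0 ≤ rs) :
    let Te : ℝ → ℝ := fun s => vth ^ 2 * (rr / s) / ((rs - rr / s) ^ 2 + xth ^ 2)
    let smax : ℝ := rr / Real.sqrt (rs ^ 2 + xth ^ 2)
    (∀ s : ℝ, 0 < s → s ≠ smax → Te s < Te smax) ∧
    Te smax = vth ^ 2 / (2 * (Real.sqrt (rs ^ 2 + xth ^ 2) - rs)) := by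
  intro Te smax
  have hq : 0 < rs ^ 2 + xth ^ 2 := by positivity
  have hD : 0 < Real.sqrt (rs ^ 2 + xth ^ 2) := Real.sqrt_pos.mpr hq
  have hD2 : Real.sqrt (rs ^ 2 + xth ^ 2) ^ 2 = rs ^ 2 + xth ^ 2 := Real.sq_sqrt hq.le
  have hlt : rs < Real.sqrt (rs ^ 2 + xth ^ 2) := by
    apply Real.lt_sqrt_of_sq_lt
    have := pow_pos hx 2
    linarith
  have hu : rr / smax = Real.sqrt (rs ^ 2 + xth ^ 2) := by
    simp only [smax]
    field_simp
  have hval : Te smax = vth ^ 2 / (2 * (Real.sqrt (rs ^ 2 + xth ^ 2) - rs)) := by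
    simp only [Te]
    rw [hu]
    generalize Real.sqrt (rs ^ 2 + xth ^ 2) = D at *
    have h1 : 0 < (rs - D) ^ 2 + xth ^ 2 := by positivity
    have h2 : 0 < 2 * (D - rs) := by linarith
    rw [div_eq_div_iff h1.ne' h2.ne']
    linear_combination (vth ^ 2) * hD2
  refine ⟨?_, hval⟩
  intro s hs0 hne
  rw [hval]
  have hne' : rr / s - Real.sqrt (rs ^ 2 + xth ^ 2) ≠ 0 := by
    intro h
    apply hne
    simp only [smax]
    rw [← sub_eq_zero.mp h]
    field_simp
  simp only [Te]
  generalize Real.sqrt (rs ^ 2 + xth ^ 2) = D at *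
  generalize rr / s = u at *
  have h1 : 0 < (rs - u) ^ 2 + xth ^ 2 := by positivity
  have h2 : 0 < 2 * (D - rs) := by linarith
  rw [div_lt_div_iff₀ h1 h2]
  have h3 : 0 < (u - D) ^ 2 := by positivity
  have h4 : 0 < vth ^ 2 * (u - D) ^ 2 := by positivity
  have h5 : vth ^ 2 * ((rs - u) ^ 2 + xth ^ 2) - vth ^ 2 * u * (2 * (D - rs))
      = vth ^ 2 * (u - D) ^ 2 := by
    linear_combination (-vth ^ 2) * hD2
  linarith
end

section
/- Fix a line reactance x_l > 0, a leakage reactance X = x_s + x_r ≥ 0, a stator resistance r_s ≥ 0, and bus voltage v_B = 1. For each magnetizing reactance m > 0 (including the capacitive compensation) define v_th(m) = m/(m + x_l), x_th(m) = m·x_l/(m + x_l) + X, and the pull-out torque T_max(m) = v_th(m)² / (2(√(r_s² + x_th(m)²) − r_s)). Then the map m ↦ T_max(m) is strictly increasing on (0, ∞); i.e., increasing the effective magnetizing reactance by capacitive compensation strictly increases the maximum electrical torque. -/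
/-- Increasing the effective magnetizing reactance `m` (by capacitive compensation)
strictly increases the pull-out torque
`T_max(m) = v_th(m)² / (2(√(r_s² + x_th(m)²) − r_s))`, where
`v_th(m) = m/(m + x_l)` and `x_th(m) = m·x_l/(m + x_l) + X` (bus voltage `v_B = 1`). -/
theorem compensation_increases_pullout_torque (xl X rs : ℝ)
    (hxl : 0 < xl) (hX : 0 ≤ X) (hrs : 0 ≤ rs) :
    let vth : ℝ → ℝ := fun m => m / (m + xl)
    let xth : ℝ → ℝ := fun m => m * xl / (m + xl) + X
    let Tmax : ℝ → ℝ := fun m => (vth m) ^ 2 / (2 * (Real.sqrt (rs ^ 2 + (xth m) ^ 2) - rs))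
    StrictMonoOn Tmax (Set.Ioi 0) := by
  intro vth xth Tmax a ha b hb hab
  have ha' : 0 < a := ha
  have hb' : 0 < b := hb
  have hva : 0 < vth a := by simp only [vth]; positivity
  have hv : vth a < vth b := by
    simp only [vth]
    rw [div_lt_div_iff₀ (by positivity) (by positivity)]
    nlinarith
  have hx : ∀ m, xth m = vth m * xl + X := by
    intro m; simp only [xth, vth]; ring
  have hxa : 0 < xth a := by rw [hx]; positivity
  have hxab : xth a < xth b := by
    rw [hx, hx]; nlinarith
  have hxb : 0 < xth b := hxa.trans hxab
  have key : ∀ m, 0 < xth m →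
      Tmax m = (vth m / xth m) ^ 2 * ((Real.sqrt (rs ^ 2 + (xth m) ^ 2) + rs) / 2) := by
    intro m hm
    simp only [Tmax]
    have hS : Real.sqrt (rs ^ 2 + (xth m) ^ 2) ^ 2 = rs ^ 2 + (xth m) ^ 2 :=
      Real.sq_sqrt (by positivity)
    have hlt : rs < Real.sqrt (rs ^ 2 + (xth m) ^ 2) :=
      Real.lt_sqrt_of_sq_lt (by nlinarith)
    generalize Real.sqrt (rs ^ 2 + (xth m) ^ 2) = S at hS hlt
    have h1 : 0 < S - rs := by linarith
    generalize vth m = v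
    generalize xth m = x at hS hm
    rw [div_pow, div_mul_div_comm, div_eq_div_iff (by positivity) (by positivity)]
    linear_combination (-2) * v ^ 2 * hS
  rw [key a hxa, key b hxb]
  have h1 : vth a / xth a ≤ vth b / xth b := by
    rw [div_le_div_iff₀ hxa hxb, hx, hx]
    nlinarith
  have h2 : Real.sqrt (rs ^ 2 + (xth a) ^ 2) < Real.sqrt (rs ^ 2 + (xth b) ^ 2) :=
    Real.sqrt_lt_sqrt (by positivity) (by nlinarith)
  have h3 : 0 < vth a / xth a := by positivity
  have h4 : (vth a / xth a) ^ 2 ≤ (vth b / xth b) ^ 2 := pow_le_pow_left₀ h3.le h1 2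
  exact mul_lt_mul' h4 (by linarith) (by positivity) (lt_of_lt_of_le (by positivity) h4)
end

section
/- Let a, b, c > 0, set λ₀ = a·c/(a + b·c), let 0 < V_w ≤ 1, and for s > 0 define λ(s) = λ₀·V_w/(s + 1) and P(s) = V_w³·(a/λ(s) − b)·e^{−c/λ(s)}. Then P is strictly decreasing on (0, ∞). -/
theorem power_aux (a b c x y : ℝ) (ha : 0 < a) (hc : 0 < c)
    (hx : a < c * (a * x - b)) (hxy : x < y) :
    (a * y - b) * Real.exp (-(c * y)) < (a * x - b) * Real.exp (-(c * x)) := by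
  have h1 := Real.add_one_le_exp (c * (y - x))
  have hpos : 0 < a * x - b := by
    by_contra h
    push Not at h
    nlinarith
  have h2 : a * y - b < (a * x - b) * Real.exp (c * (y - x)) := by
    have h3 := mul_le_mul_of_nonneg_left h1 hpos.le
    have h4 := mul_lt_mul_of_pos_right hx (sub_pos.2 hxy)
    nlinarith
  have h5 := mul_lt_mul_of_pos_right h2 (Real.exp_pos (-(c * y)))
  rw [mul_assoc, ← Real.exp_add] at h5
  have h6 : c * (y - x) + -(c * y) = -(c * x) := by ring
  rwa [h6] at h5

/-- With `λ₀ = a·c/(a + b·c)` and `0 < V_w ≤ 1`, the mechanical power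
`P(s) = V_w³·(a/λ(s) − b)·e^{−c/λ(s)}`, with `λ(s) = λ₀·V_w/(s + 1)`, is strictly
decreasing in the slip `s` on `(0, ∞)`. -/
theorem mechanical_power_strictAntiOn (a b c Vw : ℝ)
    (ha : 0 < a) (hb : 0 < b) (hc : 0 < c) (hV0 : 0 < Vw) (hV1 : Vw ≤ 1) :
    let lam0 : ℝ := a * c / (a + b * c)
    let lam : ℝ → ℝ := fun s => lam0 * Vw / (s + 1)
    let P : ℝ → ℝ := fun s => Vw ^ 3 * (a / lam s - b) * Real.exp (-c / lam s)
    StrictAntiOn P (Set.Ioi 0) := by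
  intro lam0 lam P s hs t ht hst
  have hs' : 0 < s := hs
  have hl0 : 0 < lam0 := by positivity
  have hl : 0 < lam0 * Vw := by positivity
  have hinv : ∀ u, (lam u)⁻¹ = (u + 1) / (lam0 * Vw) := fun u => inv_div _ _
  have hxy : (lam s)⁻¹ < (lam t)⁻¹ := by
    rw [hinv, hinv]
    exact div_lt_div_of_pos_right (by linarith) hl
  have h0 : a * c * lam0⁻¹ = a + b * c := by
    simp only [lam0]
    field_simp
  have hgt : lam0⁻¹ < (lam s)⁻¹ := by
    rw [hinv, inv_eq_one_div, div_lt_div_iff₀ hl0 hl]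
    nlinarith
  have hx : a < c * (a * (lam s)⁻¹ - b) := by
    have := mul_lt_mul_of_pos_left hgt (mul_pos ha hc)
    nlinarith
  have key := mul_lt_mul_of_pos_left (power_aux a b c _ _ ha hc hx hxy) (pow_pos hV0 3)
  simpa only [P, div_eq_mul_inv, neg_mul, mul_assoc] using key
end

section
/- Let a, b, c > 0, set λ₀ = a·c/(a + b·c), let 0 < V_w ≤ 1, and for s > 0 define λ(s) = λ₀·V_w/(s + 1), P(s) = V_w³·(a/λ(s) − b)·e^{−c/λ(s)}, and the mechanical torque T_m(s) = P(s)/(s + 1). If P(s) > 0 for all s in an interval I ⊆ (0, ∞), then T_m is strictly decreasing on I. -/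
theorem torque_key (a b c u v : ℝ) (ha : 0 < a) (hb : 0 < b) (hc : 0 < c) (hu : 0 < u)
    (huv : u < v) (h : a < c * (a * u - b)) :
    (a - b / v) * Real.exp (-(c * v)) < (a - b / u) * Real.exp (-(c * u)) := by
  have hv : 0 < v := hu.trans huv
  have hd : 0 < a * u - b := by
    by_contra hn
    nlinarith
  have hE : Real.exp (-(c * u)) = Real.exp (c * (v - u)) * Real.exp (-(c * v)) := by
    rw [← Real.exp_add]; congr 1; ring
  have h1 : c * (v - u) + 1 ≤ Real.exp (c * (v - u)) := Real.add_one_le_exp _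
  rw [hE, ← mul_assoc]
  apply mul_lt_mul_of_pos_right _ (Real.exp_pos _)
  have hau : a - b / u = (a * u - b) / u := by field_simp
  have hp : 0 < a - b / u := by rw [hau]; positivity
  refine lt_of_lt_of_le ?_ (mul_le_mul_of_nonneg_left h1 hp.le)
  have hk : b < v * (c * (a * u - b)) := by
    have h2 : v * a < v * (c * (a * u - b)) := mul_lt_mul_of_pos_left h hv
    nlinarith
  have : (a - b / u) * (c * (v - u) + 1) - (a - b / v)
      = (v - u) * (v * (c * (a * u - b)) - b) / (u * v) := by
    field_simp; ring
  have h3 : 0 < (v - u) * (v * (c * (a * u - b)) - b) / (u * v) :=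
    div_pos (mul_pos (by linarith) (by linarith)) (by positivity)
  linarith

/-- If the mechanical power `P` is positive on an interval `I ⊆ (0, ∞)`, then the
mechanical torque `T_m(s) = P(s)/(s + 1)` is strictly decreasing on `I`. -/
theorem mechanical_torque_strictAntiOn (a b c Vw : ℝ)
    (ha : 0 < a) (hb : 0 < b) (hc : 0 < c) (hV0 : 0 < Vw) (hV1 : Vw ≤ 1)
    (I : Set ℝ) (hI : I.OrdConnected) (hIsub : I ⊆ Set.Ioi 0) :
    let lam0 : ℝ := a * c / (a + b * c)
    let lam : ℝ → ℝ := fun s => lam0 * Vw / (s + 1)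
    let P : ℝ → ℝ := fun s => Vw ^ 3 * (a / lam s - b) * Real.exp (-c / lam s)
    let Tm : ℝ → ℝ := fun s => P s / (s + 1)
    (∀ s ∈ I, 0 < P s) → StrictAntiOn Tm I := by
  intro lam0 lam P Tm _ s hs t ht hst
  have hs0 : 0 < s := hIsub hs
  have ht0 : 0 < t := hIsub ht
  have hl0 : 0 < lam0 := by positivity
  obtain ⟨k, hk⟩ : ∃ k, k = 1 / (lam0 * Vw) := ⟨_, rfl⟩
  have hk0 : 0 < k := by rw [hk]; positivity
  have form : ∀ x, 0 < x → Tm x = Vw ^ 3 * k *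
      ((a - b / (k * (x + 1))) * Real.exp (-(c * (k * (x + 1))))) := by
    intro x hx
    have hx1 : 0 < x + 1 := by linarith
    have e1 : a / lam x = a * (k * (x + 1)) := by
      simp only [lam, hk]; field_simp
    have e2 : -c / lam x = -(c * (k * (x + 1))) := by
      simp only [lam, hk]; field_simp
    simp only [Tm, P]
    rw [e1, e2]
    field_simp
  rw [form s hs0, form t ht0]
  apply mul_lt_mul_of_pos_left _ (by positivity)
  apply torque_key a b c _ _ ha hb hc (by positivity)
  · exact mul_lt_mul_of_pos_left (by linarith) hk0
  · have hkl : 1 / lam0 ≤ k := by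
      rw [hk]
      apply one_div_le_one_div_of_le (by positivity)
      nlinarith
    have hl : a * c * (1 / lam0) = a + b * c := by
      simp only [lam0]; field_simp
    have hac : 0 < a * c := by positivity
    have h5 : a * c * (1 / lam0) ≤ a * c * k := mul_le_mul_of_nonneg_left hkl hac.le
    have h6 : 0 < a * c * k * s := by positivity
    nlinarith
end

section
/- Let T_e : (0, ∞) → ℝ be given by T_e(s) = v_th²·(r_r/s)/((r_s − r_r/s)² + x_th²) with v_th > 0, r_r > 0, x_th > 0, r_s ≥ 0, and let s_max = r_r/√(r_s² + x_th²). Let T_m : [0, s_max] → ℝ be continuous, strictly decreasing, with T_m(0) > 0 and T_m(s_max) < T_e(s_max). Then there exists a unique s₀ ∈ (0, s_max) such that T_m(s₀) = T_e(s₀); i.e., the turbine–generator system has exactly one equilibrium slip in the operating interval (0, s_max). -/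
/-- If the mechanical torque `T_m` is continuous and strictly decreasing on `[0, s_max]`
with `T_m(0) > 0` and `T_m(s_max) < T_e(s_max)`, then there is exactly one equilibrium
slip `s₀ ∈ (0, s_max)` with `T_m(s₀) = T_e(s₀)`. -/
theorem unique_equilibrium_slip (vth rr xth rs : ℝ)
    (hv : 0 < vth) (hr : 0 < rr) (hx : 0 < xth) (hs : 0 ≤ rs)
    (Te : ℝ → ℝ)
    (hTe : ∀ s : ℝ, 0 < s → Te s = vth ^ 2 * (rr / s) / ((rs - rr / s) ^ 2 + xth ^ 2))
    (smax : ℝ) (hsmax : smax = rr / Real.sqrt (rs ^ 2 + xth ^ 2))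
    (Tm : ℝ → ℝ)
    (hTmCont : ContinuousOn Tm (Set.Icc 0 smax))
    (hTmAnti : StrictAntiOn Tm (Set.Icc 0 smax))
    (hTm0 : 0 < Tm 0) (hTmEnd : Tm smax < Te smax) :
    ∃! s₀ : ℝ, s₀ ∈ Set.Ioo 0 smax ∧ Tm s₀ = Te s₀ := by
  have hZ : 0 < rs ^ 2 + xth ^ 2 := by positivity
  have hq : 0 < Real.sqrt (rs ^ 2 + xth ^ 2) := Real.sqrt_pos.mpr hZ
  have hm : 0 < smax := by rw [hsmax]; positivity
  have hm2 : (rs ^ 2 + xth ^ 2) * smax ^ 2 = rr ^ 2 := by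
    rw [hsmax, div_pow, Real.sq_sqrt hZ.le]
    field_simp
  have hD : ∀ s : ℝ, 0 < (rs * s - rr) ^ 2 + xth ^ 2 * s ^ 2 := by
    intro s
    rcases eq_or_ne s 0 with h | h
    · subst h
      have := pow_pos hr 2
      nlinarith
    · positivity
  have hg : ∀ s : ℝ, 0 < s →
      Te s = vth ^ 2 * rr * s / ((rs * s - rr) ^ 2 + xth ^ 2 * s ^ 2) := by
    intro s h
    have h1 : 0 < (rs - rr / s) ^ 2 + xth ^ 2 := by positivity
    rw [hTe s h, div_eq_div_iff h1.ne' (hD s).ne']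
    field_simp
  have hmono : ∀ s t : ℝ, 0 < s → s < t → t < smax → Te s < Te t := by
    intro s t h0 hst ht
    rw [hg s h0, hg t (h0.trans hst), div_lt_div_iff₀ (hD s) (hD t)]
    have h1 : s * t < smax ^ 2 := by nlinarith
    have h2 : 0 < rr ^ 2 - (rs ^ 2 + xth ^ 2) * (s * t) := by
      rw [← hm2]; nlinarith [mul_lt_mul_of_pos_left h1 hZ]
    have h3 : 0 < vth ^ 2 * rr * ((t - s) * (rr ^ 2 - (rs ^ 2 + xth ^ 2) * (s * t))) :=
      mul_pos (by positivity) (mul_pos (sub_pos.mpr hst) h2)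
    linarith
  have hcont : ContinuousOn
      (fun s => vth ^ 2 * rr * s / ((rs * s - rr) ^ 2 + xth ^ 2 * s ^ 2) - Tm s)
      (Set.Icc 0 smax) := by
    refine ContinuousOn.sub (Continuous.continuousOn ?_) hTmCont
    exact Continuous.div (by fun_prop) (by fun_prop) (fun s => (hD s).ne')
  obtain ⟨c, hc, hfc⟩ := intermediate_value_Ioo hm.le hcont
    (show (0 : ℝ) ∈ Set.Ioo _ _ from
      ⟨by simpa using hTm0, by
        have h := hTmEnd
        rw [hg smax hm] at h
        exact sub_pos.mpr h⟩)
  refine ⟨c, ⟨hc, ?_⟩, ?_⟩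
  · rw [hg c hc.1]
    exact (sub_eq_zero.mp hfc).symm
  · have hTc : Tm c = Te c := by
      rw [hg c hc.1]
      exact (sub_eq_zero.mp hfc).symm
    rintro y ⟨hy, hTy⟩
    have hy' := Set.Ioo_subset_Icc_self hy
    have hc' := Set.Ioo_subset_Icc_self hc
    rcases lt_trichotomy y c with h | h | h
    · have h1 := hmono y c hy.1 h hc.2
      have h2 := hTmAnti hy' hc' h
      linarith
    · exact h
    · have h1 := hmono c y hc.1 h hy.2
      have h2 := hTmAnti hc' hy' h
      linarith
end
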